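/- In the continuous-time setting with q(x_t|x₀) = N(√(α_{t|0}) x₀, β_{t|0} I) and ε_t = (x_t − √(α_{t|0}) x₀)/√(β_{t|0}), the diagonal of the conditional covariance of x_s given x_t satisfies diag(Cov_{q(x_s|x_t)}[x_s]) = β̃_{s|t} 1 + (β_{t|s}²/(β_{t|0} α_{t|s})) ( E_{q(x₀|x_t)}[ε_t²] − E_{q(x₀|x_t)}[ε_t]² ), where β̃_{s|t} = (β_{s|0}/β_{t|0}) β_{t|s} and squares are componentwise. -/

import Mathlib

open MeasureTheory

/-- `α_{t|s} = exp(2∫_s^t f)` for the SDE `dx = f(t)x dt + g(t) dw`. -/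
noncomputable def sdeAlpha (f : ℝ → ℝ) (s t : ℝ) : ℝ :=
  Real.exp (2 * ∫ τ in s..t, f τ)

/-- `β_{t|s} = ∫_s^t g(τ)² α_{t|τ} dτ` for the SDE `dx = f(t)x dt + g(t) dw`. -/
noncomputable def sdeBeta (f g : ℝ → ℝ) (s t : ℝ) : ℝ :=
  ∫ τ in s..t, (g τ) ^ 2 * sdeAlpha f τ t

/-- The isotropic Gaussian measure `N(m, v I)` on `ℝ^d` (Dirac mass if `v = 0`). -/
noncomputable def gaussMeasIso {d : ℕ} (m : Fin d → ℝ) (v : ℝ) : Measure (Fin d → ℝ) :=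
  if v = 0 then Measure.dirac m
  else volume.withDensity fun z => ENNReal.ofReal
    (((2 * Real.pi * v) ^ ((d : ℝ) / 2))⁻¹ *
      Real.exp (-(∑ i, (z i - m i) ^ 2) / (2 * v)))

/-- The continuous-time noise `ε_t(x₀) = (x_t − √α_{t|0} x₀)/√β_{t|0}`. -/
noncomputable def sdeNoise {d : ℕ} (f g : ℝ → ℝ) (t : ℝ) (xt x0 : Fin d → ℝ) : Fin d → ℝ :=
  (Real.sqrt (sdeBeta f g 0 t))⁻¹ • (xt - Real.sqrt (sdeAlpha f 0 t) • x0)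

open ProbabilityTheory

section Coefficients

variable {f g : ℝ → ℝ}

theorem sdeAlpha_pos (f : ℝ → ℝ) (s t : ℝ) : 0 < sdeAlpha f s t := Real.exp_pos _

theorem sdeAlpha_mul_sdeAlpha (hf : Continuous f) (r s t : ℝ) :
    sdeAlpha f r s * sdeAlpha f s t = sdeAlpha f r t := by
  rw [sdeAlpha, sdeAlpha, sdeAlpha, ← Real.exp_add, ← mul_add,
    intervalIntegral.integral_add_adjacent_intervals (hf.intervalIntegrable _ _)
      (hf.intervalIntegrable _ _)]

theorem continuous_sdeAlpha_left (hf : Continuous f) (t : ℝ) :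
    Continuous fun τ => sdeAlpha f τ t := by
  have h : Continuous fun τ => ∫ u in t..τ, f u :=
    intervalIntegral.continuous_primitive (fun _ _ => hf.intervalIntegrable _ _) t
  simp only [sdeAlpha, intervalIntegral.integral_symm t]
  fun_prop

theorem sdeBeta_pos (hf : Continuous f) (hg : Continuous g) (hgne : ∀ τ, g τ ≠ 0) {s t : ℝ}
    (hst : s < t) : 0 < sdeBeta f g s t := by
  have h := continuous_sdeAlpha_left hf t
  refine intervalIntegral.intervalIntegral_pos_of_pos
    (Continuous.intervalIntegrable (by fun_prop) _ _) (fun τ => ?_) hst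
  have := hgne τ
  have := sdeAlpha_pos f τ t
  positivity

theorem sdeBeta_nonneg (f g : ℝ → ℝ) {s t : ℝ} (hst : s ≤ t) : 0 ≤ sdeBeta f g s t :=
  intervalIntegral.integral_nonneg hst fun τ _ =>
    mul_nonneg (sq_nonneg _) (sdeAlpha_pos f τ t).le

end Coefficients

section IsotropicGaussian

variable {d : ℕ}

theorem prod_gaussianPDFReal (m z : Fin d → ℝ) (v : NNReal) :
    ∏ i, gaussianPDFReal (m i) v (z i) =
      ((2 * Real.pi * v) ^ ((d : ℝ) / 2))⁻¹ * Real.exp (-(∑ i, (z i - m i) ^ 2) / (2 * v)) := by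
  simp only [gaussianPDFReal, Finset.prod_mul_distrib, ← Real.exp_sum, Finset.prod_const,
    Finset.card_univ, Fintype.card_fin, ← Finset.sum_div, Finset.sum_neg_distrib]
  congr 1
  rw [inv_pow, Real.sqrt_eq_rpow, ← Real.rpow_natCast, ← Real.rpow_mul (by positivity)]
  ring_nf

theorem gaussMeasIso_eq_pi (m : Fin d → ℝ) (v : NNReal) :
    gaussMeasIso m v = Measure.pi fun i => gaussianReal (m i) v := by
  refine (Measure.pi_eq fun s hs => ?_).symm
  by_cases hv : v = 0
  · subst hv
    simp only [gaussMeasIso, NNReal.coe_zero, if_true, gaussianReal_zero_var]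
    rw [Measure.dirac_apply' _ (.univ_pi hs)]
    simp_rw [Measure.dirac_apply' _ (hs _)]
    classical
    simp [Set.indicator_apply, Finset.prod_ite_zero]
  · simp only [gaussMeasIso, NNReal.coe_eq_zero, hv, if_false, ← prod_gaussianPDFReal]
    simp_rw [gaussianReal_apply_eq_integral _ hv]
    rw [withDensity_apply _ (.univ_pi hs), volume_pi, Measure.restrict_pi_pi,
      ← ofReal_integral_eq_lintegral_ofReal
        (Integrable.fintype_prod fun i => (integrable_gaussianPDFReal (m i) v).restrict)
        (ae_of_all _ fun z => Finset.prod_nonneg fun i _ => gaussianPDFReal_nonneg _ _ _),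
      integral_fintype_prod_eq_prod (fun i => gaussianPDFReal (m i) v),
      ENNReal.ofReal_prod_of_nonneg fun i _ =>
        integral_nonneg fun z => gaussianPDFReal_nonneg _ _ _]

theorem gaussMeasIso_eq_map_add (m : Fin d → ℝ) (v : NNReal) :
    gaussMeasIso m v = (Measure.pi fun _ => gaussianReal 0 v).map (m + ·) := by
  rw [gaussMeasIso_eq_pi]
  have h (i : Fin d) : (gaussianReal 0 v).map (m i + ·) = gaussianReal (m i) v := by
    rw [gaussianReal_map_const_add, zero_add]
  have (i : Fin d) : SigmaFinite ((gaussianReal 0 v).map (m i + ·)) := by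
    rw [h]; infer_instance
  have hpi := Measure.pi_map_pi (μ := fun _ : Fin d => gaussianReal 0 v)
    (f := fun i => (m i + ·)) fun i => by fun_prop
  simp only [h] at hpi
  exact hpi.symm

theorem bind_gaussMeasIso {Ω : Type*} [MeasurableSpace Ω] (ν : Measure Ω) [SFinite ν]
    {m : Ω → Fin d → ℝ} (hm : Measurable m) (v : NNReal) :
    (ν.bind fun x => gaussMeasIso (m x) v) =
      (ν.prod (Measure.pi fun _ => gaussianReal 0 v)).map fun p => m p.1 + p.2 := by
  have hadd : Measurable fun p : Ω × (Fin d → ℝ) => m p.1 + p.2 := by fun_prop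
  have hmap (x : Ω) (s : Set (Fin d → ℝ)) (hs : MeasurableSet s) :
      gaussMeasIso (m x) v s = (Measure.pi fun _ => gaussianReal 0 v)
        (Prod.mk x ⁻¹' ((fun p : Ω × (Fin d → ℝ) => m p.1 + p.2) ⁻¹' s)) := by
    rw [gaussMeasIso_eq_map_add, Measure.map_apply (by fun_prop) hs]
    rfl
  have hmeas : Measurable fun x => gaussMeasIso (m x) v := by
    refine Measure.measurable_of_measurable_coe _ fun s hs => ?_
    simp_rw [hmap _ s hs]
    exact measurable_measure_prodMk_left (hadd hs)
  ext s hs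
  rw [Measure.bind_apply hs hmeas.aemeasurable, Measure.map_apply hadd hs,
    Measure.prod_apply (hadd hs)]
  simp_rw [hmap _ s hs]

/-- Law of total variance for a mixture of isotropic Gaussians with common variance. -/
theorem variance_bind_gaussMeasIso {Ω : Type*} [MeasurableSpace Ω] (ν : Measure Ω)
    [IsProbabilityMeasure ν] {m : Ω → Fin d → ℝ} (hm : Measurable m) (v : NNReal) (i : Fin d)
    (hmi : MemLp (fun x => m x i) 2 ν) :
    Var[fun z => z i; ν.bind fun x => gaussMeasIso (m x) v] = v + Var[fun x => m x i; ν] := by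
  have hev := measurePreserving_eval (fun _ : Fin d => gaussianReal 0 v) i
  have hL : MemLp (fun z : Fin d → ℝ => z i) 2 (Measure.pi fun _ => gaussianReal 0 v) :=
    (memLp_id_gaussianReal 2).comp_measurePreserving hev
  have hvar : Var[fun z : Fin d → ℝ => z i; Measure.pi fun _ => gaussianReal 0 v] = v := by
    rw [← variance_id_gaussianReal (μ := 0) (v := v)]
    exact hev.variance_fun_comp (f := id) aemeasurable_id
  rw [bind_gaussMeasIso ν hm, variance_map (measurable_pi_apply i).aemeasurable (by fun_prop)]
  refine (variance_add_prod hmi hL).trans ?_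
  rw [hvar, add_comm]

end IsotropicGaussian

/-- Diagonal of the conditional covariance of `x_s` given `x_t` in the continuous-time
setting: the conditional law of `x_s` given `x_t` is the mixture over the posterior
`ν = q(x₀|x_t)` of `N((√α_{t|s}β_{s|0}/β_{t|0}) x_t + (√α_{s|0}β_{t|s}/β_{t|0}) x₀, β̃_{s|t} I)`
with `β̃_{s|t} = (β_{s|0}/β_{t|0})β_{t|s}`, and its diagonal covariance entries equal
`β̃_{s|t} + (β_{t|s}²/(β_{t|0} α_{t|s}))(E_ν[ε_t²] − E_ν[ε_t]²)` componentwise. -/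
theorem cond_cov_diag_sde {d : ℕ} (f g : ℝ → ℝ)
    (hf : Continuous f) (hg : Continuous g) (hgne : ∀ τ, g τ ≠ 0)
    (s t : ℝ) (hs : 0 ≤ s) (hst : s < t)
    (ν : Measure (Fin d → ℝ)) [IsProbabilityMeasure ν]
    (xt : Fin d → ℝ)
    (hmom1 : ∀ i, Integrable (fun x : Fin d → ℝ => x i) ν)
    (hmom2 : ∀ i j, Integrable (fun x : Fin d → ℝ => x i * x j) ν) :
    ∀ i,
      (∫ z, (z i - ∫ w, w i ∂(ν.bind fun x0 => gaussMeasIso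
              ((Real.sqrt (sdeAlpha f s t) * sdeBeta f g 0 s / sdeBeta f g 0 t) • xt +
                (Real.sqrt (sdeAlpha f 0 s) * sdeBeta f g s t / sdeBeta f g 0 t) • x0)
              (sdeBeta f g 0 s / sdeBeta f g 0 t * sdeBeta f g s t))) ^ 2
          ∂(ν.bind fun x0 => gaussMeasIso
              ((Real.sqrt (sdeAlpha f s t) * sdeBeta f g 0 s / sdeBeta f g 0 t) • xt +
                (Real.sqrt (sdeAlpha f 0 s) * sdeBeta f g s t / sdeBeta f g 0 t) • x0)
              (sdeBeta f g 0 s / sdeBeta f g 0 t * sdeBeta f g s t))) =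
        sdeBeta f g 0 s / sdeBeta f g 0 t * sdeBeta f g s t +
          (sdeBeta f g s t) ^ 2 / (sdeBeta f g 0 t * sdeAlpha f s t) *
            ((∫ x0, (sdeNoise f g t xt x0 i) ^ 2 ∂ν) -
              (∫ x0, sdeNoise f g t xt x0 i ∂ν) ^ 2) := by
  intro i
  have hβt : 0 < sdeBeta f g 0 t := sdeBeta_pos hf hg hgne (hs.trans_lt hst)
  have hβst : 0 < sdeBeta f g s t := sdeBeta_pos hf hg hgne hst
  have hβs : 0 ≤ sdeBeta f g 0 s := sdeBeta_nonneg f g hs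
  have hαs := sdeAlpha_pos f 0 s
  have hαst := sdeAlpha_pos f s t
  have hαt := sdeAlpha_mul_sdeAlpha hf 0 s t
  have hx : MemLp (fun x : Fin d → ℝ => x i) 2 ν := by
    rw [memLp_two_iff_integrable_sq (hmom1 i).aestronglyMeasurable]
    simpa only [sq] using hmom2 i i
  have hnoise : MemLp (fun x0 => sdeNoise f g t xt x0 i) 2 ν :=
    ((memLp_const (xt i)).sub (hx.const_mul _)).const_mul _
  have hvarnoise : Var[fun x0 => sdeNoise f g t xt x0 i; ν] =
      sdeAlpha f 0 t / sdeBeta f g 0 t * Var[fun x => x i; ν] := by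
    simp only [sdeNoise, Pi.smul_apply, Pi.sub_apply, smul_eq_mul]
    rw [variance_const_mul, variance_const_sub (hx.const_mul _).aestronglyMeasurable,
      variance_const_mul, inv_pow, Real.sq_sqrt hβt.le, Real.sq_sqrt (sdeAlpha_pos f 0 t).le]
    ring
  obtain ⟨v, hv⟩ : ∃ v : NNReal,
      (v : ℝ) = sdeBeta f g 0 s / sdeBeta f g 0 t * sdeBeta f g s t :=
    ⟨⟨_, by positivity⟩, rfl⟩
  obtain ⟨b, hb⟩ : ∃ b, b = Real.sqrt (sdeAlpha f 0 s) * sdeBeta f g s t / sdeBeta f g 0 t :=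
    ⟨_, rfl⟩
  rw [← hv, ← hb]
  generalize Real.sqrt (sdeAlpha f s t) * sdeBeta f g 0 s / sdeBeta f g 0 t = a
  have hm : MemLp (fun x0 : Fin d → ℝ => (a • xt + b • x0) i) 2 ν :=
    (memLp_const (a * xt i)).add (hx.const_mul b)
  have htotal := variance_bind_gaussMeasIso ν (m := fun x0 => a • xt + b • x0) (by fun_prop) v i hm
  rw [variance_eq_integral (measurable_pi_apply i).aemeasurable] at htotal
  have hsub := variance_eq_sub hnoise
  simp only [Pi.pow_apply] at hsub
  rw [htotal, ← hsub, hvarnoise]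
  simp only [Pi.add_apply, Pi.smul_apply, smul_eq_mul]
  rw [variance_const_add (hx.const_mul b).aestronglyMeasurable, variance_const_mul, ← hαt, hb,
    div_pow, mul_pow, Real.sq_sqrt hαs.le]
  field_simp
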